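/- arXiv:alg-geom/9703001 — 2 statements merged into one kernel-verified Lean document; each statement's English description precedes it below -/
import Mathlib

section
/- Let P be an infinite subset of the positive integers. Then for all η, ζ ∈ S_∞: if η ≼ ζ then φ_P(η) ≼ φ_P(ζ), and |φ_P(ζ)| = |ζ|; thus φ_P is an injection of graded posets (S_∞, ≼) → (S_∞, ≼). Consequently, if ζ and η are shape equivalent, then there is an order isomorphism between [e,ζ]_≼ := {ξ : ξ ≼ ζ} and [e,η]_≼ := {ξ : ξ ≼ η}. -/
/-- `S_∞`: a permutation of the positive integers lies in `S_∞` iff it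
fixes all but finitely many integers. -/
def finSupp (w : Equiv.Perm ℕ+) : Prop := {i : ℕ+ | w i ≠ i}.Finite

/-- The length `ℓ(w) = #{(i,j) : i < j and w(i) > w(j)}`. -/
noncomputable def len (w : Equiv.Perm ℕ+) : ℕ :=
  {p : ℕ+ × ℕ+ | p.1 < p.2 ∧ w p.2 < w p.1}.ncard

/-- Cover relation of the `k`-Bruhat order: `w = u∘(a,b)` with `a ≤ k < b`
and `ℓ(w) = ℓ(u) + 1`. -/
def kBruhatCover (k : ℕ) (u w : Equiv.Perm ℕ+) : Prop :=
  ∃ a b : ℕ+, (a : ℕ) ≤ k ∧ k < (b : ℕ) ∧ w = u * Equiv.swap a b ∧ len w = len u + 1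

/-- The `k`-Bruhat order `≤_k`: reflexive–transitive closure of the cover relation. -/
def kBruhatLE (k : ℕ) : Equiv.Perm ℕ+ → Equiv.Perm ℕ+ → Prop :=
  Relation.ReflTransGen (kBruhatCover k)

/-- The rank `|ζ|` as an integer. -/
noncomputable def zlen (ζ : Equiv.Perm ℕ+) : ℤ :=
  ({p : ℕ+ × ℕ+ | p.1 ∈ (⇑ζ) '' {α | α < ζ α} ∧ p.2 ∈ (⇑ζ) '' {β | ζ β < β} ∧ p.2 < p.1}.ncard : ℤ)
    - ({p : ℕ+ × ℕ+ | p.1 < ζ p.1 ∧ p.2 < ζ p.2 ∧ p.2 < p.1 ∧ ζ p.1 < ζ p.2}.ncard : ℤ)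
    - ({p : ℕ+ × ℕ+ | ζ p.1 < p.1 ∧ ζ p.2 < p.2 ∧ p.2 < p.1 ∧ ζ p.1 < ζ p.2}.ncard : ℤ)
    - ({p : ℕ+ × ℕ+ | p.1 < ζ p.1 ∧ ζ p.2 < p.2 ∧ p.2 < p.1}.ncard : ℤ)

/-- The relation `≼` on `S_∞`: `η ≼ ζ` iff there exist a positive integer `k`
and `u ∈ S_∞` with `u ≤_k η∘u ≤_k ζ∘u`. -/
def preceq (η ζ : Equiv.Perm ℕ+) : Prop :=
  ∃ k : ℕ, 0 < k ∧ ∃ u : Equiv.Perm ℕ+, finSupp u ∧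
    kBruhatLE k u (η * u) ∧ kBruhatLE k (η * u) (ζ * u)

/-- `isPhi p ζ φ` says that `φ = φ_P(ζ)` where `P` is the range of the strictly
monotone enumeration `p`: `φ` fixes everything outside `P` and `φ(p_i) = p_{ζ(i)}`. -/
def isPhi (p : ℕ+ → ℕ+) (ζ φ : Equiv.Perm ℕ+) : Prop :=
  (∀ i, φ (p i) = p (ζ i)) ∧ ∀ x : ℕ+, x ∉ Set.range p → φ x = x

section

open Function Set

theorem finSupp_iff {u : Equiv.Perm ℕ+} : finSupp u ↔ ∃ N : ℕ+, ∀ i, N < i → u i = i := by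
  constructor
  · intro h
    obtain ⟨N, hN⟩ := h.bddAbove
    exact ⟨N, fun i hi => by_contra fun hne => absurd (hN hne) (not_le.2 hi)⟩
  · rintro ⟨N, hN⟩
    refine (Set.finite_Iic N).subset fun i hi => ?_
    by_contra h
    exact hi (hN i (not_le.1 h))

theorem finSupp.mul_swap {u : Equiv.Perm ℕ+} (hu : finSupp u) (a b : ℕ+) :
    finSupp (u * Equiv.swap a b) := by
  refine (hu.union (Set.toFinite {a, b})).subset fun i hi => ?_
  by_contra h
  simp only [mem_union, mem_insert_iff, mem_singleton_iff, mem_ofPred_eq, not_or, not_not] at h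
  exact hi (by simp [Equiv.swap_apply_of_ne_of_ne h.2.1 h.2.2, h.1])

/-- The inversion set of a permutation. -/
def inversions (u : Equiv.Perm ℕ+) : Set (ℕ+ × ℕ+) := {p | p.1 < p.2 ∧ u p.2 < u p.1}

theorem len_eq_ncard (u : Equiv.Perm ℕ+) : len u = (inversions u).ncard := rfl

theorem mem_inversions {u : Equiv.Perm ℕ+} {i j : ℕ+} :
    (i, j) ∈ inversions u ↔ i < j ∧ u j < u i := Iff.rfl

theorem finSupp.finite_inversions {u : Equiv.Perm ℕ+} (hu : finSupp u) :
    (inversions u).Finite := by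
  obtain ⟨N, hN⟩ := finSupp_iff.1 hu
  refine ((Set.finite_Iic N).prod (Set.finite_Iic N)).subset ?_
  rintro ⟨i, j⟩ ⟨hij, hu⟩
  have hj : j ≤ N := by
    by_contra hj
    rw [not_le] at hj
    simp only [hN j hj] at hu
    have := u.injective (hN (u i) (hj.trans hu))
    exact lt_asymm hij (this ▸ hu)
  exact ⟨(hij.le.trans hj : i ≤ N), hj⟩

/-- For `i < j`, move the pair `(i, j)` by the transposition `(a, b)` whenever this keeps the two
entries in increasing order. -/
def swapPair (a b : ℕ+) (x : ℕ+ × ℕ+) : ℕ+ × ℕ+ :=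
  if Equiv.swap a b x.1 < Equiv.swap a b x.2 then (Equiv.swap a b x.1, Equiv.swap a b x.2) else x

theorem swapPair_swapPair {a b : ℕ+} {x : ℕ+ × ℕ+} (hx : x.1 < x.2) :
    swapPair a b (swapPair a b x) = x := by
  unfold swapPair
  split_ifs <;> simp_all

theorem fst_lt_snd_swapPair {a b : ℕ+} {x : ℕ+ × ℕ+} (hx : x.1 < x.2) :
    (swapPair a b x).1 < (swapPair a b x).2 := by
  unfold swapPair
  split_ifs <;> simp_all

section

variable {u : Equiv.Perm ℕ+} {a b : ℕ+}

theorem injOn_swapPair : InjOn (swapPair a b) (inversions u) := fun x hx y hy h => by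
  rw [← swapPair_swapPair (a := a) (b := b) hx.1, h, swapPair_swapPair hy.1]

theorem swapPair_mem_inversions (hab : a < b) (h : u a < u b) {x : ℕ+ × ℕ+}
    (hx : x ∈ inversions u) : swapPair a b x ∈ inversions (u * Equiv.swap a b) := by
  obtain ⟨i, j⟩ := x
  obtain ⟨hij, hu⟩ := hx
  refine ⟨fst_lt_snd_swapPair hij, ?_⟩
  unfold swapPair
  split_ifs with hs
  · simpa using hu
  · simp only [Equiv.Perm.mul_apply, Equiv.swap_apply_def] at hs ⊢
    grind

theorem mk_notMem_image_swapPair (hab : a < b) (h : u a < u b) :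
    (a, b) ∉ swapPair a b '' inversions u := by
  rintro ⟨⟨i, j⟩, ⟨hij, hu⟩, hx⟩
  have := swapPair_swapPair (a := a) (b := b) (x := (i, j)) hij
  rw [hx] at this
  simp only [swapPair, Equiv.swap_apply_left, Equiv.swap_apply_right] at this
  grind

theorem insert_image_swapPair_subset (hab : a < b) (h : u a < u b) :
    insert (a, b) (swapPair a b '' inversions u) ⊆ inversions (u * Equiv.swap a b) := by
  refine insert_subset ⟨hab, by simpa using h⟩ ?_
  rintro _ ⟨x, hx, rfl⟩
  exact swapPair_mem_inversions hab h hx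

theorem finSupp.ncard_insert_image_swapPair (hu : finSupp u) (hab : a < b) (h : u a < u b) :
    (insert (a, b) (swapPair a b '' inversions u)).ncard = len u + 1 := by
  rw [ncard_insert_of_notMem (mk_notMem_image_swapPair hab h) (hu.finite_inversions.image _),
    injOn_swapPair.ncard_image, len_eq_ncard]

theorem finSupp.len_lt_len_mul_swap (hu : finSupp u) (hab : a < b) (h : u a < u b) :
    len u < len (u * Equiv.swap a b) := by
  rw [← Nat.succ_le_iff, Nat.succ_eq_add_one, ← hu.ncard_insert_image_swapPair hab h]
  exact ncard_le_ncard (insert_image_swapPair_subset hab h) (hu.mul_swap a b).finite_inversions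

theorem finSupp.len_mul_swap_eq_iff (hu : finSupp u) (hab : a < b) (h : u a < u b) :
    len (u * Equiv.swap a b) = len u + 1 ↔
      ∀ c, a < c → c < b → ¬ (u a < u c ∧ u c < u b) := by
  rw [← hu.ncard_insert_image_swapPair hab h]
  have hsub := insert_image_swapPair_subset hab h
  constructor
  · intro heq c hac hcb hc
    have hmem : (a, c) ∈ inversions (u * Equiv.swap a b) := by
      refine ⟨hac, ?_⟩
      simpa [Equiv.swap_apply_of_ne_of_ne hac.ne' hcb.ne] using hc.2
    rw [← eq_of_subset_of_ncard_le hsub heq.le (hu.mul_swap a b).finite_inversions] at hmem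
    rcases hmem with hmem | ⟨x, hx, hxc⟩
    · grind
    · have := swapPair_swapPair (a := a) (b := b) hx.1
      rw [hxc] at this
      simp only [swapPair, Equiv.swap_apply_left, Equiv.swap_apply_of_ne_of_ne hac.ne' hcb.ne,
        if_neg hcb.not_gt] at this
      rw [← this] at hx
      exact lt_asymm hx.2 hc.1
  · intro hc
    rw [len_eq_ncard]
    congr 1
    refine Subset.antisymm ?_ hsub
    rintro ⟨i, j⟩ ⟨hij, hw⟩
    by_cases hx : (i, j) = (a, b)
    · exact Or.inl hx
    refine Or.inr ⟨swapPair a b (i, j), ⟨fst_lt_snd_swapPair hij, ?_⟩, swapPair_swapPair hij⟩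
    unfold swapPair
    split_ifs with hs
    · exact hw
    · simp only [Equiv.Perm.mul_apply, Equiv.swap_apply_def] at hs hw ⊢
      have hib : i ≠ b → u i < u b ∨ u b < u i := fun h => lt_or_gt_of_ne (u.injective.ne h)
      have hja : j ≠ a → u j < u a ∨ u a < u j := fun h => lt_or_gt_of_ne (u.injective.ne h)
      grind

theorem finSupp.kBruhatCover_iff (hu : finSupp u) {k : ℕ} {w : Equiv.Perm ℕ+} :
    kBruhatCover k u w ↔ ∃ a b : ℕ+, (a : ℕ) ≤ k ∧ k < (b : ℕ) ∧ w = u * Equiv.swap a b ∧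
      u a < u b ∧ ∀ c, a < c → c < b → ¬ (u a < u c ∧ u c < u b) := by
  refine exists₂_congr fun a b => and_congr_right fun ha => and_congr_right fun hb =>
    and_congr_right fun hw => ?_
  have hab : a < b := PNat.coe_lt_coe _ _ |>.1 (ha.trans_lt hb)
  subst hw
  constructor
  · intro hlen
    have h : u a < u b := by
      by_contra h
      have h : u b < u a := lt_of_le_of_ne (not_lt.1 h) (u.injective.ne hab.ne')
      have := (hu.mul_swap a b).len_lt_len_mul_swap hab (by simpa using h)
      rw [mul_assoc, Equiv.swap_mul_self, mul_one] at this
      omega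
    exact ⟨h, (hu.len_mul_swap_eq_iff hab h).1 hlen⟩
  · rintro ⟨h, hc⟩
    exact (hu.len_mul_swap_eq_iff hab h).2 hc

end

theorem finSupp.of_kBruhatCover {k : ℕ} {u w : Equiv.Perm ℕ+} (hu : finSupp u)
    (h : kBruhatCover k u w) : finSupp w := by
  obtain ⟨a, b, -, -, rfl, -⟩ := h
  exact hu.mul_swap a b

theorem finSupp.of_kBruhatLE {k : ℕ} {u w : Equiv.Perm ℕ+} (hu : finSupp u)
    (h : kBruhatLE k u w) : finSupp w := by
  induction h with
  | refl => exact hu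
  | tail _ h ih => exact ih.of_kBruhatCover h

theorem finSupp.le_of_kBruhatCover {k : ℕ} {u w : Equiv.Perm ℕ+} (hu : finSupp u)
    (h : kBruhatCover k u w) (i : ℕ+) :
    ((i : ℕ) ≤ k → u i ≤ w i) ∧ (k < (i : ℕ) → w i ≤ u i) := by
  obtain ⟨a, b, ha, hb, rfl, hlt, -⟩ := hu.kBruhatCover_iff.1 h
  simp only [Equiv.Perm.mul_apply, Equiv.swap_apply_def]
  split_ifs with h1 h2
  · subst h1
    exact ⟨fun _ => hlt.le, fun h => by omega⟩
  · subst h2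
    exact ⟨fun h => by omega, fun _ => hlt.le⟩
  · exact ⟨fun _ => le_rfl, fun _ => le_rfl⟩

theorem finSupp.le_of_kBruhatLE {k : ℕ} {u w : Equiv.Perm ℕ+} (hu : finSupp u)
    (h : kBruhatLE k u w) (i : ℕ+) :
    ((i : ℕ) ≤ k → u i ≤ w i) ∧ (k < (i : ℕ) → w i ≤ u i) := by
  induction h with
  | refl => exact ⟨fun _ => le_rfl, fun _ => le_rfl⟩
  | tail h' h ih =>
    have := (hu.of_kBruhatLE h').le_of_kBruhatCover h i
    exact ⟨fun hi => (ih.1 hi).trans (this.1 hi), fun hi => (this.2 hi).trans (ih.2 hi)⟩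

theorem finSupp.eq_of_kBruhatLE {k : ℕ} {u v w : Equiv.Perm ℕ+} (hu : finSupp u)
    (huv : kBruhatLE k u v) (hvw : kBruhatLE k v w) {i : ℕ+} (h : w i = u i) : v i = u i := by
  have h1 := hu.le_of_kBruhatLE huv i
  have h2 := (hu.of_kBruhatLE huv).le_of_kBruhatLE hvw i
  rw [h] at h2
  rcases le_or_gt (i : ℕ) k with hi | hi
  · exact le_antisymm (h2.1 hi) (h1.1 hi)
  · exact le_antisymm (h1.2 hi) (h2.2 hi)

/-- Transport of a chain in the `k`-Bruhat order that only moves positions in `S`: the positions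
in `S` are relabelled by `f` and the values in `T` are relabelled by `g`. -/
theorem kBruhatLE.transport {k k' : ℕ} {S T : Set ℕ+} {f g : ℕ+ → ℕ+} (hf : StrictMonoOn f S)
    (hg : StrictMonoOn g T) (hk : ∀ i ∈ S, (f i : ℕ) ≤ k' ↔ (i : ℕ) ≤ k)
    (hfill : ∀ a ∈ S, ∀ b ∈ S, ∀ c, f a < c → c < f b → c ∈ f '' S)
    {v w : Equiv.Perm ℕ+} (hv : finSupp v) (h : kBruhatLE k v w) (hS : ∀ i, i ∉ S → w i = v i)
    {v' : Equiv.Perm ℕ+} (hv' : finSupp v') (hR : ∀ i ∈ S, v i ∈ T ∧ v' (f i) = g (v i)) :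
    ∃ w', kBruhatLE k' v' w' ∧ (∀ i ∈ S, w i ∈ T ∧ w' (f i) = g (w i)) ∧
      ∀ i, i ∉ f '' S → w' i = v' i := by
  unfold kBruhatLE at h
  induction h using Relation.ReflTransGen.head_induction_on generalizing v' with
  | refl => exact ⟨v', .refl, hR, fun _ _ => rfl⟩
  | @head v m hvm hmw ih =>
    have hm := hv.of_kBruhatCover hvm
    have hmv : ∀ i, i ∉ S → m i = v i := fun i hi =>
      hv.eq_of_kBruhatLE (.single hvm) hmw (hS i hi)
    obtain ⟨a, b, ha, hb, rfl, hlt, hc⟩ := hv.kBruhatCover_iff.1 hvm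
    have haS : a ∈ S := by
      by_contra h
      have := hmv a h
      simp only [Equiv.Perm.mul_apply, Equiv.swap_apply_left] at this
      exact hlt.ne' this
    have hbS : b ∈ S := by
      by_contra h
      have := hmv b h
      simp only [Equiv.Perm.mul_apply, Equiv.swap_apply_right] at this
      exact hlt.ne this
    have hcov : kBruhatCover k' v' (v' * Equiv.swap (f a) (f b)) := by
      refine hv'.kBruhatCover_iff.2 ⟨f a, f b, (hk a haS).2 ha,
        not_le.1 fun h => hb.not_ge ((hk b hbS).1 h), rfl, ?_, fun c hac hcb h => ?_⟩
      · rw [(hR a haS).2, (hR b hbS).2]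
        exact hg (hR a haS).1 (hR b hbS).1 hlt
      · obtain ⟨c, hcS, rfl⟩ := hfill a haS b hbS c hac hcb
        rw [(hR a haS).2, (hR b hbS).2, (hR c hcS).2,
          hg.lt_iff_lt (hR a haS).1 (hR c hcS).1, hg.lt_iff_lt (hR c hcS).1 (hR b hbS).1] at h
        exact hc c ((hf.lt_iff_lt haS hcS).1 hac) ((hf.lt_iff_lt hcS hbS).1 hcb) h
    have hR' : ∀ i ∈ S, (v * Equiv.swap a b) i ∈ T ∧
        (v' * Equiv.swap (f a) (f b)) (f i) = g ((v * Equiv.swap a b) i) := by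
      intro i hi
      simp only [Equiv.Perm.mul_apply, Equiv.swap_apply_def, hf.injOn.eq_iff hi haS,
        hf.injOn.eq_iff hi hbS]
      split_ifs
      exacts [hR b hbS, hR a haS, hR i hi]
    obtain ⟨w', hw', hRw, hoff⟩ := ih hm (fun i hi => (hS i hi).trans (hmv i hi).symm)
      (hv'.mul_swap (f a) (f b)) hR'
    refine ⟨w', hw'.head hcov, hRw, fun i hi => (hoff i hi).trans ?_⟩
    have hia : i ≠ f a := fun h => hi ⟨a, haS, h.symm⟩
    have hib : i ≠ f b := fun h => hi ⟨b, hbS, h.symm⟩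
    simp [Equiv.swap_apply_of_ne_of_ne hia hib]

theorem exists_finSupp_extending {f : ℕ+ → ℕ+} (hf : Injective f) (N : ℕ+) :
    ∃ u : Equiv.Perm ℕ+, finSupp u ∧ ∀ i ≤ N, u i = f i := by
  induction N using PNat.recOn with
  | one =>
    refine ⟨1 * Equiv.swap 1 (f 1), finSupp.mul_swap (by simp [finSupp]) _ _, fun i hi => ?_⟩
    obtain rfl : i = 1 := le_antisymm hi (one_le)
    simp
  | succ n ih =>
    obtain ⟨u, hu, h⟩ := ih
    refine ⟨u * Equiv.swap (n + 1) (u.symm (f (n + 1))), hu.mul_swap _ _, fun i hi => ?_⟩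
    rcases eq_or_lt_of_le hi with rfl | hi
    · simp
    · have hin : i ≤ n := PNat.lt_add_one_iff.1 hi
      have hne : i ≠ u.symm (f (n + 1)) := fun he =>
        hi.ne (hf ((h i hin).symm.trans ((Equiv.eq_symm_apply u).1 he)))
      simp [Equiv.swap_apply_of_ne_of_ne hi.ne hne, h i hin]

theorem preceq.map {p : ℕ+ → ℕ+} (hp : StrictMono p) {η ζ φη φζ : Equiv.Perm ℕ+}
    (hη : isPhi p η φη) (hζ : isPhi p ζ φζ) (h : preceq η ζ) : preceq φη φζ := by
  obtain ⟨k, hk, u, hu, h1, h2⟩ := h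
  have hu1 := hu.of_kBruhatLE h1
  have hu2 := hu1.of_kBruhatLE h2
  obtain ⟨N, hN⟩ : ∃ N : ℕ+, ∀ i, N < i → u i = i ∧ η (u i) = i ∧ ζ (u i) = i := by
    obtain ⟨N, hN⟩ := finSupp_iff.1 hu
    obtain ⟨N₁, hN₁⟩ := finSupp_iff.1 hu1
    obtain ⟨N₂, hN₂⟩ := finSupp_iff.1 hu2
    exact ⟨N ⊔ N₁ ⊔ N₂, fun i hi => by
      simp only [sup_lt_iff] at hi
      exact ⟨hN i hi.1.1, hN₁ i hi.1.2, hN₂ i hi.2⟩⟩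
  obtain ⟨u', hu', hu'p⟩ := exists_finSupp_extending (hp.injective.comp u.injective) N
  have himage : (id : ℕ+ → ℕ+) '' Iic N = Iic N := image_id _
  have hfill : ∀ a ∈ Iic N, ∀ b ∈ Iic N, ∀ c, id a < c → c < id b → c ∈ id '' Iic N :=
    fun a _ b hb c _ hcb => by rw [himage]; exact hcb.le.trans hb
  have hfix : ∀ θ φ : Equiv.Perm ℕ+, isPhi p θ φ → (∀ i, N < i → θ (u i) = i) →
      ∀ i, N < i → φ (u' i) = u' i := by
    intro θ φ hφ hθ i hi
    by_cases hr : u' i ∈ range p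
    · obtain ⟨j, hj⟩ := hr
      obtain ⟨l, rfl⟩ := u.surjective j
      have hl : N < l := by
        by_contra hl
        rw [← comp_apply (f := p), ← hu'p l (not_lt.1 hl)] at hj
        exact hl (u'.injective hj ▸ hi)
      rw [← hj, hφ.1, hθ l hl, (hN l hl).1]
    · exact hφ.2 _ hr
  have heq : ∀ θ φ w' : Equiv.Perm ℕ+, isPhi p θ φ → (∀ i, N < i → θ (u i) = i) →
      (∀ i ≤ N, w' i = p (θ (u i))) → (∀ i, N < i → w' i = u' i) → w' = φ * u' := by
    intro θ φ w' hφ hθ h1 h2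
    ext1 i
    rcases le_or_gt i N with hi | hi
    · rw [h1 i hi, Equiv.Perm.mul_apply, hu'p i hi, comp_apply, hφ.1]
    · rw [h2 i hi, Equiv.Perm.mul_apply, hfix θ φ hφ hθ i hi]
  obtain ⟨w₁, hw₁, hR₁, hoff₁⟩ := kBruhatLE.transport (k' := k) (S := Iic N) (T := univ)
    (f := id) (strictMono_id.strictMonoOn _) (hp.strictMonoOn _) (fun _ _ => Iff.rfl) hfill hu h1
    (fun i hi => (hN i (not_le.1 hi)).2.1.trans (hN i (not_le.1 hi)).1.symm) hu'
    (fun i hi => ⟨mem_univ _, hu'p i hi⟩)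
  obtain ⟨w₂, hw₂, hR₂, hoff₂⟩ := kBruhatLE.transport (k' := k) (S := Iic N) (T := univ)
    (f := id) (strictMono_id.strictMonoOn _) (hp.strictMonoOn _) (fun _ _ => Iff.rfl) hfill hu1 h2
    (fun i hi => (hN i (not_le.1 hi)).2.2.trans (hN i (not_le.1 hi)).2.1.symm)
    (hu'.of_kBruhatLE hw₁) hR₁
  rw [himage] at hoff₁ hoff₂
  have e₁ : w₁ = φη * u' := heq η φη w₁ hη (fun i hi => (hN i hi).2.1) (fun i hi => (hR₁ i hi).2)
    fun i hi => hoff₁ i (not_le.2 hi)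
  have e₂ : w₂ = φζ * u' := heq ζ φζ w₂ hζ (fun i hi => (hN i hi).2.2) (fun i hi => (hR₂ i hi).2)
    fun i hi => (hoff₂ i (not_le.2 hi)).trans (hoff₁ i (not_le.2 hi))
  exact ⟨k, hk, u', hu', e₁ ▸ hw₁, e₁ ▸ e₂ ▸ hw₂⟩

theorem exists_strictMono_range_eq {A : Set ℕ+} (hA : A.Infinite) :
    ∃ q : ℕ+ → ℕ+, StrictMono q ∧ range q = A := by
  classical
  have hB : ((OrderIso.pnatIsoNat : ℕ+ → ℕ) '' A).Infinite :=
    hA.image OrderIso.pnatIsoNat.injective.injOn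
  have := hB.to_subtype
  refine ⟨fun i => OrderIso.pnatIsoNat.symm (Nat.orderEmbeddingOfSet
    ((OrderIso.pnatIsoNat : ℕ+ → ℕ) '' A) (OrderIso.pnatIsoNat i)), ?_, ?_⟩
  · exact OrderIso.pnatIsoNat.symm.strictMono.comp
      ((Nat.orderEmbeddingOfSet _).strictMono.comp OrderIso.pnatIsoNat.strictMono)
  · rw [range_comp' OrderIso.pnatIsoNat.symm, range_comp' (Nat.orderEmbeddingOfSet _),
      OrderIso.pnatIsoNat.surjective.range_eq, image_univ, Nat.orderEmbeddingOfSet_range,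
      ← image_comp]
    simp

theorem exists_perm_of_mem_range_iff {p q : ℕ+ → ℕ+} (hp : Injective p) (hq : Injective q)
    (σ : Equiv.Perm ℕ+) (h : ∀ i, σ i ∈ range p ↔ i ∈ range q) :
    ∃ τ : Equiv.Perm ℕ+, ∀ i, σ (q i) = p (τ i) := by
  choose τ hτ using fun i => (h (q i)).2 ⟨i, rfl⟩
  refine ⟨Equiv.ofBijective τ ⟨fun i j hij => ?_, fun j => ?_⟩, fun i => (hτ i).symm⟩
  · exact hq (σ.injective (by rw [← hτ, ← hτ, hij]))
  · obtain ⟨i, hi⟩ := (h (σ.symm (p j))).1 (by simp)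
    exact ⟨i, hp (by rw [hτ, hi, Equiv.apply_symm_apply])⟩

theorem exists_le_iff_of_strictMono {q : ℕ+ → ℕ+} (hq : StrictMono q) (k' : ℕ) :
    ∃ k : ℕ, ∀ i : ℕ+, (i : ℕ) ≤ k ↔ (q i : ℕ) ≤ k' := by
  classical
  have hex : ∃ n : ℕ, k' < (q n.succPNat : ℕ) :=
    ⟨k', lt_of_lt_of_le (Nat.lt_succ_self k')
      ((PNat.coe_le_coe k'.succPNat _).2 hq.le_apply)⟩
  refine ⟨Nat.find hex, fun i => ⟨fun hi => ?_, fun hi => ?_⟩⟩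
  · have := Nat.find_min hex (m := i.natPred) (by have := i.natPred_add_one; omega)
    rw [PNat.succPNat_natPred] at this
    exact not_lt.1 this
  · by_contra h
    have hle : (Nat.find hex).succPNat ≤ i := PNat.coe_le_coe _ _ |>.1 (by
      rw [Nat.succPNat_coe]; omega)
    have := PNat.coe_le_coe _ _ |>.2 (hq.monotone hle)
    have := Nat.find_spec hex
    omega

theorem finSupp.of_apply_eq {p q : ℕ+ → ℕ+} (hp : StrictMono p) (hq : StrictMono q)
    {σ τ : Equiv.Perm ℕ+} (hσ : finSupp σ) (h : ∀ i, σ (q i) = p (τ i)) : finSupp τ := by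
  obtain ⟨N, hN⟩ := finSupp_iff.1 hσ
  have hlt : ∀ j K, N < K → (σ j ≤ K ↔ j ≤ K) := by
    intro j K hK
    rcases le_or_gt j N with hj | hj
    · refine iff_of_true ?_ (hj.trans hK.le)
      by_contra hc
      rw [not_le] at hc
      exact (hj.trans_lt (hK.trans hc)).ne' (σ.injective (hN _ (hK.trans hc)))
    · rw [hN j hj]
  refine finSupp_iff.2 ⟨N, fun i hi => ?_⟩
  have hK : N < q i := hi.trans_le hq.le_apply
  have himg : (Finset.Icc 1 i).map τ.toEmbedding = Finset.Icc 1 (τ i) := by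
    ext j
    obtain ⟨j, rfl⟩ := τ.surjective j
    have := hlt (q j) (q i) hK
    rw [h, hq.le_iff_le, (hN _ hK).symm.trans (h i), hp.le_iff_le] at this
    simp [this]
  have := congrArg Finset.card himg
  rw [Finset.card_map, PNat.card_Icc, PNat.card_Icc] at this
  exact PNat.coe_injective (by simpa using this.symm)

theorem kBruhatLE.max_one {k : ℕ} {u w : Equiv.Perm ℕ+} (h : kBruhatLE k u w) :
    kBruhatLE (max k 1) u w := by
  refine Relation.ReflTransGen.mono ?_ _ _ h
  rintro u w ⟨a, b, ha, hb⟩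
  rw [max_eq_left (Nat.one_le_iff_ne_zero.2 (a.pos.trans_le ha).ne')]
  exact ⟨a, b, ha, hb⟩

theorem exists_preceq_of_preceq_isPhi {p : ℕ+ → ℕ+} (hp : StrictMono p) {ξ γ x : Equiv.Perm ℕ+}
    (hγ : isPhi p ξ γ) (h : preceq x γ) : ∃ x', isPhi p x' x ∧ preceq x' ξ := by
  obtain ⟨k', hk', u', hu', h1, h2⟩ := h
  have hu1 := hu'.of_kBruhatLE h1
  have hfixu : ∀ i, u' i ∉ range p → (x * u') i = u' i := fun i hi =>
    hu'.eq_of_kBruhatLE h1 h2 (hγ.2 _ hi)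
  have hfix : ∀ v, v ∉ range p → x v = v := fun v hv => by
    simpa using hfixu (u'.symm v) (by simpa using hv)
  obtain ⟨x', hx'⟩ := exists_perm_of_mem_range_iff hp.injective hp.injective x fun i => by
    constructor
    · exact fun h => by_contra fun hi => hi (hfix i hi ▸ h)
    · intro hi
      by_contra hc
      exact hc ((x.injective (hfix _ hc)).symm ▸ hi)
  obtain ⟨q, hq, hqr⟩ := exists_strictMono_range_eq (A := u' ⁻¹' range p)
    ((infinite_range_of_injective hp.injective).preimage (by simp [u'.surjective.range_eq]))
  obtain ⟨u, hu⟩ := exists_perm_of_mem_range_iff hp.injective hq.injective u' fun i => by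
    rw [hqr, mem_preimage]
  have hu0 : finSupp u := hu'.of_apply_eq hp hq hu
  obtain ⟨k, hk⟩ := exists_le_iff_of_strictMono hq k'
  have hinvq : LeftInverse (invFun q) q := leftInverse_invFun hq.injective
  have hinvp : LeftInverse (invFun p) p := leftInverse_invFun hp.injective
  have hmono : ∀ {r : ℕ+ → ℕ+}, StrictMono r → StrictMonoOn (invFun r) (range r) := by
    rintro r hr _ ⟨i, rfl⟩ _ ⟨j, rfl⟩ hij
    simpa only [leftInverse_invFun hr.injective _] using hr.lt_iff_lt.1 hij
  have himage : invFun q '' range q = univ :=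
    eq_univ_of_forall fun i => ⟨q i, ⟨i, rfl⟩, hinvq i⟩
  have hkS : ∀ i : ℕ+, i ∈ range q → (((invFun q i : ℕ+) : ℕ) ≤ k ↔ (i : ℕ) ≤ k') := by
    rintro _ ⟨i, rfl⟩
    rw [hinvq, hk]
  have hfill : ∀ a ∈ range q, ∀ b ∈ range q, ∀ c, invFun q a < c → c < invFun q b →
      c ∈ invFun q '' range q := fun _ _ _ _ c _ _ => himage ▸ mem_univ c
  have hmem : ∀ i, i ∉ range q → u' i ∉ range p := fun i hi => by rwa [hqr] at hi
  obtain ⟨w₁, hw₁, hR₁, -⟩ := kBruhatLE.transport (k' := k) (hmono hq) (hmono hp) hkS hfill hu' h1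
    (fun i hi => hfixu i (hmem i hi)) hu0 (by
      rintro _ ⟨i, rfl⟩
      rw [hu, hinvq, hinvp]
      exact ⟨⟨_, rfl⟩, rfl⟩)
  obtain ⟨w₂, hw₂, hR₂, -⟩ := kBruhatLE.transport (k' := k) (hmono hq) (hmono hp) hkS hfill hu1 h2
    (fun i hi => (hγ.2 _ (hmem i hi)).trans (hfixu i (hmem i hi)).symm)
    (hu0.of_kBruhatLE hw₁) hR₁
  have e₁ : w₁ = x' * u := by
    ext1 i
    have := (hR₁ (q i) ⟨i, rfl⟩).2
    rwa [hinvq, Equiv.Perm.mul_apply, hu, hx', hinvp] at this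
  have e₂ : w₂ = ξ * u := by
    ext1 i
    have := (hR₂ (q i) ⟨i, rfl⟩).2
    rwa [hinvq, Equiv.Perm.mul_apply, hu, hγ.1, hinvp] at this
  exact ⟨x', ⟨hx', hfix⟩, max k 1, by simp, u, hu0, (e₁ ▸ hw₁).max_one, (e₁ ▸ e₂ ▸ hw₂).max_one⟩

theorem isPhi.left_unique {p : ℕ+ → ℕ+} (hp : Injective p) {ζ η φ : Equiv.Perm ℕ+}
    (hζ : isPhi p ζ φ) (hη : isPhi p η φ) : ζ = η :=
  Equiv.ext fun i => hp ((hζ.1 i).symm.trans (hη.1 i))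

theorem isPhi.right_unique {p : ℕ+ → ℕ+} {ζ φ ψ : Equiv.Perm ℕ+} (hφ : isPhi p ζ φ)
    (hψ : isPhi p ζ ψ) : φ = ψ := by
  ext1 x
  by_cases hx : x ∈ range p
  · obtain ⟨i, rfl⟩ := hx
    rw [hφ.1, hψ.1]
  · rw [hφ.2 x hx, hψ.2 x hx]

theorem isPhi.preceq_iff {p : ℕ+ → ℕ+} (hp : StrictMono p) {η ζ φη φζ : Equiv.Perm ℕ+}
    (hη : isPhi p η φη) (hζ : isPhi p ζ φζ) : preceq φη φζ ↔ preceq η ζ := by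
  refine ⟨fun h => ?_, preceq.map hp hη hζ⟩
  obtain ⟨x, hx, hle⟩ := exists_preceq_of_preceq_isPhi hp hζ h
  rwa [hη.left_unique hp.injective hx]

theorem exists_isPhi {p : ℕ+ → ℕ+} (hp : Injective p) (ζ : Equiv.Perm ℕ+) :
    ∃ φ, isPhi p ζ φ :=
  ⟨ζ.viaEmbedding ⟨p, hp⟩, fun i => Equiv.Perm.viaEmbedding_apply ζ ⟨p, hp⟩ i,
    fun x hx => Equiv.Perm.viaEmbedding_apply_of_notMem ζ ⟨p, hp⟩ x hx⟩

theorem isPhi.zlen_eq {p : ℕ+ → ℕ+} (hp : StrictMono p) {ζ φ : Equiv.Perm ℕ+}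
    (h : isPhi p ζ φ) : zlen φ = zlen ζ := by
  have hrange : ∀ x, φ x ≠ x → ∃ i, p i = x := fun x hx => by_contra fun hc => hx (h.2 x hc)
  have hcard : ∀ s t : Set (ℕ+ × ℕ+), (∀ i j, (p i, p j) ∈ s ↔ (i, j) ∈ t) →
      (∀ x ∈ s, (∃ i, p i = x.1) ∧ ∃ j, p j = x.2) → s.ncard = t.ncard := by
    intro s t hst hs
    rw [← ncard_image_of_injective t (hp.injective.prodMap hp.injective)]
    congr 1
    ext ⟨x, y⟩
    constructor
    · intro hx
      obtain ⟨⟨i, rfl⟩, j, rfl⟩ := hs _ hx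
      exact ⟨(i, j), (hst i j).1 hx, rfl⟩
    · rintro ⟨⟨i, j⟩, hij, hx⟩
      exact hx ▸ (hst i j).2 hij
  have hup : ∀ i, p i ∈ φ '' {α | α < φ α} ↔ i ∈ ζ '' {α | α < ζ α} := by
    intro i
    constructor
    · rintro ⟨x, hx, hxi⟩
      obtain ⟨j, rfl⟩ := hrange x (ne_of_gt hx)
      rw [mem_ofPred_eq, h.1, hp.lt_iff_lt] at hx
      exact ⟨j, hx, hp.injective ((h.1 j).symm.trans hxi)⟩
    · rintro ⟨j, hj, rfl⟩
      exact ⟨p j, by rw [mem_ofPred_eq, h.1]; exact hp hj, h.1 j⟩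
  have hdown : ∀ i, p i ∈ φ '' {α | φ α < α} ↔ i ∈ ζ '' {α | ζ α < α} := by
    intro i
    constructor
    · rintro ⟨x, hx, hxi⟩
      obtain ⟨j, rfl⟩ := hrange x (ne_of_lt hx)
      rw [mem_ofPred_eq, h.1, hp.lt_iff_lt] at hx
      exact ⟨j, hx, hp.injective ((h.1 j).symm.trans hxi)⟩
    · rintro ⟨j, hj, rfl⟩
      exact ⟨p j, by rw [mem_ofPred_eq, h.1]; exact hp hj, h.1 j⟩
  have himage : ∀ x, φ x ≠ x → ∃ i, p i = φ x := fun x hx => by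
    obtain ⟨i, rfl⟩ := hrange x hx
    exact ⟨_, (h.1 i).symm⟩
  unfold zlen
  congr 1
  · congr 1
    · congr 1
      · congr 1
        refine hcard _ _ (fun i j => ?_) ?_
        · simp only [mem_ofPred_eq, hup, hdown, hp.lt_iff_lt]
        · rintro ⟨x, y⟩ ⟨⟨a, ha, rfl⟩, ⟨b, hb, rfl⟩, -⟩
          exact ⟨himage a (ne_of_gt ha), himage b (ne_of_lt hb)⟩
      · congr 1
        refine hcard _ _ (fun i j => ?_) fun x hx => ⟨hrange _ hx.1.ne', hrange _ hx.2.1.ne'⟩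
        simp only [mem_ofPred_eq, h.1, hp.lt_iff_lt]
    · congr 1
      refine hcard _ _ (fun i j => ?_) fun x hx => ⟨hrange _ hx.1.ne, hrange _ hx.2.1.ne⟩
      simp only [mem_ofPred_eq, h.1, hp.lt_iff_lt]
  · congr 1
    refine hcard _ _ (fun i j => ?_) fun x hx => ⟨hrange _ hx.1.ne', hrange _ hx.2.1.ne⟩
    simp only [mem_ofPred_eq, h.1, hp.lt_iff_lt]

end

/-- Theorem 3.2.3(v): for an infinite `P ⊂ ℕ` (given by its strictly monotone
enumeration `p`), `φ_P` is an injection of graded posets `(S_∞,≼) → (S_∞,≼)`;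
consequently shape-equivalent permutations have order-isomorphic lower
intervals `[e,ζ]_≼ ≅ [e,η]_≼`. -/
theorem stmt11 (p : ℕ+ → ℕ+) (hp : StrictMono p) :
    (∀ ζ η φζ φη : Equiv.Perm ℕ+, finSupp ζ → finSupp η →
      isPhi p ζ φζ → isPhi p η φη →
      (preceq η ζ → preceq φη φζ) ∧ (φζ = φη → ζ = η) ∧ zlen φζ = zlen ζ) ∧
    (∀ ζ η : Equiv.Perm ℕ+, finSupp ζ → finSupp η →
      (∃ (ξ : Equiv.Perm ℕ+) (q r : ℕ+ → ℕ+), finSupp ξ ∧ StrictMono q ∧ StrictMono r ∧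
        isPhi q ξ ζ ∧ isPhi r ξ η) →
      ∃ Φ : Equiv.Perm ℕ+ → Equiv.Perm ℕ+,
        Set.BijOn Φ {x | preceq x ζ} {x | preceq x η} ∧
        ∀ x y : Equiv.Perm ℕ+, preceq x ζ → preceq y ζ →
          (preceq x y ↔ preceq (Φ x) (Φ y))) := by
  refine ⟨fun ζ η φζ φη _ _ hζ hη => ⟨preceq.map hp hη hζ, fun h => ?_, hζ.zlen_eq hp⟩, ?_⟩
  · subst h
    exact hζ.left_unique hp.injective hη
  rintro ζ η - - ⟨ξ, q, r, -, hq, hr, hζ, hη⟩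
  choose F hF using exists_isPhi hq.injective
  choose G hG using exists_isPhi hr.injective
  have hFinj : Function.Injective F := fun x y hxy =>
    (hF x).left_unique hq.injective (hxy ▸ hF y)
  have hGinj : Function.Injective G := fun x y hxy =>
    (hG x).left_unique hr.injective (hxy ▸ hG y)
  have hFinv : ∀ x, Function.invFun F (F x) = x := Function.leftInverse_invFun hFinj
  have hFex : ∀ x, preceq x ζ → ∃ x', preceq x' ξ ∧ F x' = x := by
    intro x hx
    obtain ⟨x', hx', hle⟩ := exists_preceq_of_preceq_isPhi hq hζ hx
    exact ⟨x', hle, (hF x').right_unique hx'⟩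
  have hGex : ∀ x, preceq x η → ∃ x', preceq x' ξ ∧ G x' = x := by
    intro x hx
    obtain ⟨x', hx', hle⟩ := exists_preceq_of_preceq_isPhi hr hη hx
    exact ⟨x', hle, (hG x').right_unique hx'⟩
  refine ⟨G ∘ Function.invFun F, ⟨?_, ?_, ?_⟩, ?_⟩
  · intro x hx
    obtain ⟨x', hle, rfl⟩ := hFex x hx
    simp only [Function.comp_apply, hFinv]
    exact ((hG x').preceq_iff hr hη).2 hle
  · intro x hx y hy hxy
    obtain ⟨x', -, rfl⟩ := hFex x hx
    obtain ⟨y', -, rfl⟩ := hFex y hy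
    simp only [Function.comp_apply, hFinv] at hxy
    rw [hGinj hxy]
  · intro y hy
    obtain ⟨y', hle, rfl⟩ := hGex y hy
    exact ⟨F y', ((hF y').preceq_iff hq hζ).2 hle, by simp only [Function.comp_apply, hFinv]⟩
  · intro x y hx hy
    obtain ⟨x', -, rfl⟩ := hFex x hx
    obtain ⟨y', -, rfl⟩ := hFex y hy
    simp only [Function.comp_apply, hFinv]
    rw [(hF x').preceq_iff hq (hF y'), (hG x').preceq_iff hr (hG y')]
end

section
/- Let ζ, η ∈ S_∞ be disjoint permutations. Then for every u ∈ S_∞ and every positive integer k: u ≤_k ζ∘η∘u if and only if u ≤_k ζ∘u and u ≤_k η∘u. -/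
/-- `ζ` and `η` are disjoint: their supports are disjoint and `|ζ∘η| = |ζ| + |η|`. -/
def disjointPerm (ζ η : Equiv.Perm ℕ+) : Prop :=
  (∀ i : ℕ+, ζ i ≠ i → η i = i) ∧ zlen (ζ * η) = zlen ζ + zlen η

open Finset in
/-- Splitting two indices off a double sum. -/
theorem sum_sum_split_pair {ι M : Type*} [DecidableEq ι] [AddCommMonoid M] (F : Finset ι)
    {a b : ι} (ha : a ∈ F) (hb : b ∈ F) (hab : a ≠ b) (φ : ι → ι → M) :
    ∑ i ∈ F, ∑ j ∈ F, φ i j = (φ a a + φ a b + φ b a + φ b b)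
      + ∑ e ∈ (F.erase a).erase b, (φ a e + φ b e + φ e a + φ e b)
      + ∑ i ∈ (F.erase a).erase b, ∑ j ∈ (F.erase a).erase b, φ i j := by
  have key : ∀ ψ : ι → M, ∑ i ∈ F, ψ i = ψ a + (ψ b + ∑ e ∈ (F.erase a).erase b, ψ e) := by
    intro ψ
    rw [add_sum_erase _ ψ (mem_erase.2 ⟨hab.symm, hb⟩), add_sum_erase _ ψ ha]
  simp only [key, sum_add_distrib]
  abel

theorem finSupp.exists_bound {w : Equiv.Perm ℕ+} (hw : finSupp w) :
    ∃ N : ℕ+, ∀ i, N < i → w i = i := by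
  obtain ⟨N, hN⟩ := Set.Finite.bddAbove hw
  exact ⟨N, fun i hi => by_contra fun h => absurd (hN h) (not_le.2 hi)⟩

theorem finSupp.mul {u w : Equiv.Perm ℕ+} (hu : finSupp u) (hw : finSupp w) :
    finSupp (u * w) := by
  refine (Set.Finite.union hu hw).subset fun i hi => ?_
  by_contra h
  simp only [Set.mem_union, Set.mem_ofPred_eq, not_or, not_not] at h
  exact hi (by rw [Equiv.Perm.mul_apply, h.2, h.1])

theorem finSupp_swap (a b : ℕ+) : finSupp (Equiv.swap a b) := by
  refine (Set.toFinite {a, b}).subset fun i hi => ?_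
  by_contra h
  simp only [Set.mem_insert_iff, Set.mem_singleton_iff, not_or] at h
  exact hi (Equiv.swap_apply_of_ne_of_ne h.1 h.2)

theorem len_eq_sum {w : Equiv.Perm ℕ+} {N : ℕ+} (hN : ∀ i, N < i → w i = i) :
    (len w : ℤ) = ∑ i ∈ Finset.Icc 1 N, ∑ j ∈ Finset.Icc 1 N,
      if i < j ∧ w j < w i then (1 : ℤ) else 0 := by
  have hset : {p : ℕ+ × ℕ+ | p.1 < p.2 ∧ w p.2 < w p.1} =
      ((Finset.Icc 1 N ×ˢ Finset.Icc 1 N).filter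
        fun p : ℕ+ × ℕ+ => p.1 < p.2 ∧ w p.2 < w p.1 : Finset (ℕ+ × ℕ+)) := by
    ext ⟨i, j⟩
    simp only [Set.mem_ofPred_eq, Finset.coe_filter, Finset.mem_product, Finset.mem_Icc,
      one_le, true_and, iff_and_self]
    rintro ⟨hij, hw⟩
    have hj : j ≤ N := by
      by_contra! h
      rw [hN j h] at hw
      have := w.injective (hN (w i) (h.trans hw))
      exact absurd (hij.trans hw) (by rw [this]; exact lt_irrefl _)
    exact ⟨hij.le.trans hj, hj⟩
  rw [len, hset, Set.ncard_coe_finset, ← Finset.sum_product', Finset.card_filter]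
  push_cast
  rfl

theorem len_mul_swap {u : Equiv.Perm ℕ+} (hu : finSupp u) {a b : ℕ+} (hab : a < b)
    (hlt : u a < u b) :
    (len (u * Equiv.swap a b) : ℤ) = len u + 1 +
      2 * ((Finset.Ioo a b).filter fun e => u a < u e ∧ u e < u b).card := by
  obtain ⟨N₀, hN₀⟩ := hu.exists_bound
  let N := max N₀ b
  have hN : ∀ i, N < i → u i = i := fun i hi => hN₀ i ((le_max_left _ _).trans_lt hi)
  have hbN : b ≤ N := le_max_right _ _
  have hN' : ∀ i, N < i → (u * Equiv.swap a b) i = i := fun i hi => by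
    rw [Equiv.Perm.mul_apply, Equiv.swap_apply_of_ne_of_ne
      ((hab.trans_le hbN).trans hi).ne' (hbN.trans_lt hi).ne', hN i hi]
  have ha : a ∈ Finset.Icc 1 N := Finset.mem_Icc.2 ⟨one_le, hab.le.trans hbN⟩
  have hb : b ∈ Finset.Icc 1 N := Finset.mem_Icc.2 ⟨one_le, hbN⟩
  rw [len_eq_sum hN, len_eq_sum hN', sum_sum_split_pair _ ha hb hab.ne,
    sum_sum_split_pair _ ha hb hab.ne]
  set G := ((Finset.Icc 1 N).erase a).erase b with hG
  have hv : ∀ e ∈ G, (u * Equiv.swap a b) e = u e := fun e he => by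
    simp only [hG, Finset.mem_erase] at he
    rw [Equiv.Perm.mul_apply, Equiv.swap_apply_of_ne_of_ne he.2.1 he.1]
  have hva : (u * Equiv.swap a b) a = u b := by simp
  have hvb : (u * Equiv.swap a b) b = u a := by simp
  have hcard : ((((Finset.Ioo a b).filter fun e => u a < u e ∧ u e < u b).card : ℕ) : ℤ) =
      ∑ e ∈ G, if (a < e ∧ e < b) ∧ u a < u e ∧ u e < u b then (1 : ℤ) else 0 := by
    rw [← Finset.natCast_card_filter]
    congr 2
    ext e
    simp only [hG, Finset.mem_filter, Finset.mem_Ioo, Finset.mem_erase, Finset.mem_Icc,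
      one_le, true_and]
    constructor
    · rintro ⟨⟨h1, h2⟩, h3⟩
      exact ⟨⟨h2.ne, h1.ne', h2.le.trans hbN⟩, ⟨h1, h2⟩, h3⟩
    · rintro ⟨_, h⟩
      exact h
  have hGG : ∑ i ∈ G, ∑ j ∈ G, (if i < j ∧ (u * Equiv.swap a b) j < (u * Equiv.swap a b) i
        then (1 : ℤ) else 0) = ∑ i ∈ G, ∑ j ∈ G, if i < j ∧ u j < u i then (1 : ℤ) else 0 :=
    Finset.sum_congr rfl fun i hi => Finset.sum_congr rfl fun j hj => by rw [hv i hi, hv j hj]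
  rw [hGG, hcard, Finset.mul_sum, hva, hvb]
  have hcross : ∀ e ∈ G,
      ((if a < e ∧ (u * Equiv.swap a b) e < u b then (1 : ℤ) else 0) +
        (if b < e ∧ (u * Equiv.swap a b) e < u a then 1 else 0) +
        (if e < a ∧ u b < (u * Equiv.swap a b) e then 1 else 0) +
        (if e < b ∧ u a < (u * Equiv.swap a b) e then 1 else 0)) =
      ((if a < e ∧ u e < u a then (1 : ℤ) else 0) +
        (if b < e ∧ u e < u b then 1 else 0) +
        (if e < a ∧ u a < u e then 1 else 0) +
        (if e < b ∧ u b < u e then 1 else 0)) +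
      2 * (if (a < e ∧ e < b) ∧ u a < u e ∧ u e < u b then (1 : ℤ) else 0) := by
    intro e he
    rw [hv e he]
    simp only [hG, Finset.mem_erase] at he
    have h1 : u e ≠ u a := fun h => he.2.1 (u.injective h)
    have h2 : u e ≠ u b := fun h => he.1 (u.injective h)
    have h3 := he.1
    have h4 := he.2.1
    simp only [← PNat.coe_lt_coe, ← PNat.coe_inj, ne_eq] at *
    split_ifs <;> omega
  rw [Finset.sum_congr rfl hcross, Finset.sum_add_distrib]
  simp only [lt_irrefl, hab, hlt, hab.not_gt, hlt.not_gt, false_and, and_false, if_false,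
    true_and, if_true]
  ring

/-- Condition for `u ≤_k w` to hold, stated position by position: positions `≤ k` go up,
positions `> k` go down, and non-inversions on either side of `k` are preserved. -/
structure KBruhatCriterion (k : ℕ) (u w : Equiv.Perm ℕ+) : Prop where
  le_left : ∀ a : ℕ+, (a : ℕ) ≤ k → u a ≤ w a
  le_right : ∀ b : ℕ+, k < (b : ℕ) → w b ≤ u b
  mono_left : ∀ a b : ℕ+, a < b → (b : ℕ) ≤ k → u a < u b → w a < w b
  mono_right : ∀ a b : ℕ+, a < b → k < (a : ℕ) → u a < u b → w a < w b

theorem KBruhatCriterion.refl (k : ℕ) (u : Equiv.Perm ℕ+) : KBruhatCriterion k u u :=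
  ⟨fun _ _ => le_rfl, fun _ _ => le_rfl, fun _ _ _ _ h => h, fun _ _ _ _ h => h⟩

theorem KBruhatCriterion.trans {k : ℕ} {u v w : Equiv.Perm ℕ+} (h₁ : KBruhatCriterion k u v)
    (h₂ : KBruhatCriterion k v w) : KBruhatCriterion k u w :=
  ⟨fun a ha => (h₁.le_left a ha).trans (h₂.le_left a ha),
    fun b hb => (h₂.le_right b hb).trans (h₁.le_right b hb),
    fun a b hab hb h => h₂.mono_left a b hab hb (h₁.mono_left a b hab hb h),
    fun a b hab ha h => h₂.mono_right a b hab ha (h₁.mono_right a b hab ha h)⟩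

theorem kBruhatCover.criterion {k : ℕ} {u w : Equiv.Perm ℕ+} (hu : finSupp u)
    (h : kBruhatCover k u w) : KBruhatCriterion k u w := by
  obtain ⟨a, b, hak, hkb, rfl, hlen⟩ := h
  have hab : a < b := PNat.coe_lt_coe _ _ |>.1 (by omega)
  have hlt : u a < u b := by
    by_contra! hle
    have hlt' : u b < u a := lt_of_le_of_ne hle fun h => hab.ne' (u.injective h)
    have := len_mul_swap (hu.mul (finSupp_swap a b)) hab
      (by simpa using hlt')
    rw [mul_assoc, Equiv.swap_mul_self, mul_one] at this
    omega
  have hempty : ∀ e, a < e → e < b → u a < u e → u b < u e := by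
    have h0 := len_mul_swap hu hab hlt
    have : ((Finset.Ioo a b).filter fun e => u a < u e ∧ u e < u b).card = 0 := by omega
    rw [Finset.card_eq_zero, Finset.filter_eq_empty_iff] at this
    intro e h1 h2 h3
    have h4 := this (Finset.mem_Ioo.2 ⟨h1, h2⟩)
    exact lt_of_le_of_ne (not_lt.1 fun h => h4 ⟨h3, h⟩) fun h => h2.ne' (u.injective h)
  have hval : ∀ e, e ≠ a → e ≠ b → (u * Equiv.swap a b) e = u e := fun e h1 h2 => by
    rw [Equiv.Perm.mul_apply, Equiv.swap_apply_of_ne_of_ne h1 h2]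
  have hva : (u * Equiv.swap a b) a = u b := by simp
  have hvb : (u * Equiv.swap a b) b = u a := by simp
  have hneb : ∀ c : ℕ+, (c : ℕ) ≤ k → c ≠ b := by rintro c hc rfl; omega
  have hnea : ∀ c : ℕ+, k < (c : ℕ) → c ≠ a := by rintro c hc rfl; omega
  refine ⟨fun c hc => ?_, fun c hc => ?_, fun c d hcd hd h => ?_, fun c d hcd hc h => ?_⟩
  · rcases eq_or_ne c a with rfl | hca
    · rw [hva]; exact hlt.le
    · rw [hval c hca (hneb c hc)]
  · rcases eq_or_ne c b with rfl | hcb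
    · rw [hvb]; exact hlt.le
    · rw [hval c (hnea c hc) hcb]
  · have hcd' := PNat.coe_lt_coe _ _ |>.2 hcd
    have hcb := hneb c (by omega)
    have hdb := hneb d hd
    rcases eq_or_ne c a with rfl | hca
    · rw [hva, hval d hcd.ne' hdb]
      exact hempty d hcd (PNat.coe_lt_coe _ _ |>.1 (by omega)) h
    · rw [hval c hca hcb]
      rcases eq_or_ne d a with rfl | hda
      · rw [hva]; exact h.trans hlt
      · rwa [hval d hda hdb]
  · have hcd' := PNat.coe_lt_coe _ _ |>.2 hcd
    have hca := hnea c hc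
    have hda := hnea d (by omega)
    rcases eq_or_ne c b with rfl | hcb
    · rw [hvb, hval d hda hcd.ne']
      exact hlt.trans h
    · rw [hval c hca hcb]
      rcases eq_or_ne d b with rfl | hdb
      · rw [hvb]
        refine lt_of_le_of_ne (not_lt.1 fun h' => ?_) fun h => hca (u.injective h)
        exact (hempty c (PNat.coe_lt_coe _ _ |>.1 (by omega)) hcd h').not_gt h
      · rwa [hval d hda hdb]

theorem kBruhatLE.criterion {k : ℕ} {u w : Equiv.Perm ℕ+} (hu : finSupp u)
    (h : kBruhatLE k u w) : KBruhatCriterion k u w := by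
  suffices finSupp w ∧ KBruhatCriterion k u w from this.2
  induction h with
  | refl => exact ⟨hu, KBruhatCriterion.refl k u⟩
  | tail _ hc ih =>
    refine ⟨?_, ih.2.trans (hc.criterion ih.1)⟩
    obtain ⟨a, b, -, -, rfl, -⟩ := hc
    exact ih.1.mul (finSupp_swap a b)

theorem Equiv.Perm.eq_one_of_apply_le {σ : Equiv.Perm ℕ+} (h : ∀ x, σ x ≤ x) : σ = 1 := by
  ext1 x
  induction x using WellFoundedLT.induction with
  | ind x ih =>
    by_contra hx
    have hlt : σ x < x := lt_of_le_of_ne (h x) hx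
    exact hx (σ.injective (ih _ hlt))

theorem KBruhatCriterion.exists_lt {k : ℕ} {u w : Equiv.Perm ℕ+} (h : KBruhatCriterion k u w)
    (hne : u ≠ w) : ∃ a : ℕ+, (a : ℕ) ≤ k ∧ u a < w a := by
  by_contra! hcon
  refine hne ?_
  have : w * u⁻¹ = 1 := Equiv.Perm.eq_one_of_apply_le fun x => by
    obtain ⟨y, rfl⟩ := u.surjective x
    rw [Equiv.Perm.mul_apply, Equiv.Perm.inv_def, Equiv.symm_apply_apply]
    rcases le_or_gt (y : ℕ) k with hy | hy
    · exact hcon y hy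
    · exact h.le_right y hy
  exact (mul_inv_eq_one.1 this).symm

/-- Given the criterion and `u ≠ w`, one can move one cover up from `u` towards `w`. -/
theorem KBruhatCriterion.exists_cover {k : ℕ} {u w : Equiv.Perm ℕ+} (hu : finSupp u)
    (h : KBruhatCriterion k u w) (hne : u ≠ w) :
    ∃ a b : ℕ+, (a : ℕ) ≤ k ∧ k < (b : ℕ) ∧ u a < u b ∧ u b ≤ w a ∧
      kBruhatCover k u (u * Equiv.swap a b) ∧ KBruhatCriterion k (u * Equiv.swap a b) w := by
  -- `a`: the position `≤ k` that moves up, of maximal value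
  obtain ⟨a, ⟨hak, haw⟩, hamax⟩ : ∃ a : ℕ+, ((a : ℕ) ≤ k ∧ u a < w a) ∧
      ∀ c : ℕ+, (c : ℕ) ≤ k → u a < u c → w c = u c := by
    have hfin : {a : ℕ+ | (a : ℕ) ≤ k ∧ u a < w a}.Finite :=
      ((Set.finite_Iic k).preimage PNat.coe_injective.injOn).subset fun a ha => ha.1
    obtain ⟨a, ha, hmax⟩ := hfin.exists_maximalFor u _ (h.exists_lt hne)
    refine ⟨a, ha, fun c hc hlt => ?_⟩
    by_contra hcw
    have : u c < w c := lt_of_le_of_ne (h.le_left c hc) (Ne.symm hcw)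
    exact (hmax ⟨hc, this⟩ hlt.le).not_gt hlt
  -- the values in `(u a, w a]` cannot all be mapped into themselves
  obtain ⟨b₀, hb₀⟩ : ∃ b : ℕ+, k < (b : ℕ) ∧ u a < u b ∧ u b ≤ w a ∧ w b ≤ u a := by
    by_contra! hcon
    let S : Finset ℕ+ := (Finset.Ioc (u a) (w a)).image u.symm
    have hmaps : ∀ c ∈ insert a S, w c ∈ Finset.Ioc (u a) (w a) := by
      intro c hc
      rw [Finset.mem_insert] at hc
      rcases hc with rfl | hc
      · exact Finset.mem_Ioc.2 ⟨haw, le_rfl⟩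
      · obtain ⟨x, hx, rfl⟩ := Finset.mem_image.1 hc
        obtain ⟨c, rfl⟩ := u.surjective x
        rw [Finset.mem_Ioc] at hx ⊢
        rw [Equiv.symm_apply_apply]
        rcases le_or_gt (c : ℕ) k with hck | hck
        · rw [hamax c hck hx.1]; exact hx
        · exact ⟨hcon c hck hx.1 hx.2, (h.le_right c hck).trans hx.2⟩
    have hcard := Finset.card_le_card_of_injOn w hmaps w.injective.injOn
    have haS : a ∉ S := by
      intro ha
      obtain ⟨x, hx, hxa⟩ := Finset.mem_image.1 ha
      rw [Equiv.symm_apply_eq] at hxa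
      rw [hxa, Finset.mem_Ioc] at hx
      exact lt_irrefl _ hx.1
    rw [Finset.card_insert_of_notMem haS, Finset.card_image_of_injective _ u.symm.injective] at hcard
    omega
  -- `b`: among those, the one of minimal value
  obtain ⟨b, ⟨hkb, hab, hbw, hwb⟩, hbmin⟩ := exists_minimalFor_of_wellFoundedLT
    (fun b : ℕ+ => k < (b : ℕ) ∧ u a < u b ∧ u b ≤ w a ∧ w b ≤ u a) u ⟨b₀, hb₀⟩
  have hbmin' : ∀ c : ℕ+, k < (c : ℕ) → u a < u c → u c < u b → u a < w c := by
    intro c hc h1 h2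
    by_contra! h3
    exact (hbmin ⟨hc, h1, h2.le.trans hbw, h3⟩ h2.le).not_gt h2
  have hlt : a < b := PNat.coe_lt_coe _ _ |>.1 (by omega)
  have hval : ∀ e, e ≠ a → e ≠ b → (u * Equiv.swap a b) e = u e := fun e h1 h2 => by
    rw [Equiv.Perm.mul_apply, Equiv.swap_apply_of_ne_of_ne h1 h2]
  have hva : (u * Equiv.swap a b) a = u b := by simp
  have hvb : (u * Equiv.swap a b) b = u a := by simp
  have hneb : ∀ c : ℕ+, (c : ℕ) ≤ k → c ≠ b := by rintro c hc rfl; omega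
  have hnea : ∀ c : ℕ+, k < (c : ℕ) → c ≠ a := by rintro c hc rfl; omega
  refine ⟨a, b, hak, hkb, hab, hbw, ⟨a, b, hak, hkb, rfl, ?_⟩,
    fun c hc => ?_, fun c hc => ?_, fun c d hcd hd h' => ?_, fun c d hcd hc h' => ?_⟩
  · have h0 := len_mul_swap hu hlt hab
    have : (Finset.Ioo a b).filter (fun e => u a < u e ∧ u e < u b) = ∅ := by
      rw [Finset.filter_eq_empty_iff]
      rintro e he ⟨h1, h2⟩
      rw [Finset.mem_Ioo] at he
      rcases le_or_gt (e : ℕ) k with hek | hek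
      · have h3 := h.mono_left a e he.1 hek h1
        rw [hamax e hek h1] at h3
        exact (h2.trans_le hbw).not_gt h3
      · have h3 := h.mono_right e b he.2 hek h2
        exact (h3.trans_le hwb).not_gt (hbmin' e hek h1 h2)
    rw [this, Finset.card_empty] at h0
    omega
  · rcases eq_or_ne c a with rfl | hca
    · rwa [hva]
    · rw [hval c hca (hneb c hc)]; exact h.le_left c hc
  · rcases eq_or_ne c b with rfl | hcb
    · rwa [hvb]
    · rw [hval c (hnea c hc) hcb]; exact h.le_right c hc
  · have hcd' := PNat.coe_lt_coe _ _ |>.2 hcd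
    have hck : (c : ℕ) ≤ k := by omega
    have hdb := hneb d hd
    rcases eq_or_ne c a with rfl | hca
    · rw [hva, hval d hcd.ne' hdb] at h'
      exact h.mono_left _ _ hcd hd (hab.trans h')
    · rw [hval c hca (hneb c hck)] at h'
      rcases eq_or_ne d a with rfl | hda
      · rw [hva] at h'
        rcases lt_or_ge (u d) (u c) with h1 | h1
        · rw [hamax c hck h1]; exact h'.trans_le hbw
        · exact h.mono_left _ _ hcd hd (lt_of_le_of_ne h1 fun h => hca (u.injective h))
      · rw [hval d hda hdb] at h'
        exact h.mono_left _ _ hcd hd h'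
  · have hcd' := PNat.coe_lt_coe _ _ |>.2 hcd
    have hca := hnea c hc
    have hdk : k < (d : ℕ) := by omega
    have hda := hnea d hdk
    rcases eq_or_ne c b with rfl | hcb
    · rw [hvb, hval d hda hcd.ne'] at h'
      rcases lt_or_ge (u d) (u c) with h1 | h1
      · exact hwb.trans_lt (hbmin' d hdk h' h1)
      · exact h.mono_right _ _ hcd hc (lt_of_le_of_ne h1 fun h => hcd.ne (u.injective h))
    · rw [hval c hca hcb] at h'
      rcases eq_or_ne d b with rfl | hdb
      · rw [hvb] at h'
        exact h.mono_right _ _ hcd hc (h'.trans hab)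
      · rw [hval d hda hdb] at h'
        exact h.mono_right _ _ hcd hc h'

theorem KBruhatCriterion.kBruhatLE {k : ℕ+} {u w : Equiv.Perm ℕ+} (hu : finSupp u)
    (h : KBruhatCriterion k u w) : kBruhatLE k u w := by
  induction hn : ∑ a ∈ Finset.Icc 1 k, ((w a : ℕ) - (u a : ℕ))
    using Nat.strong_induction_on generalizing u with
  | _ n ih =>
  rcases eq_or_ne u w with rfl | hne
  · exact Relation.ReflTransGen.refl
  obtain ⟨a, b, hak, hkb, hab, hbw, hcov, hcrit⟩ := h.exists_cover hu hne
  refine Relation.ReflTransGen.head hcov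
    (ih _ ?_ (hu.mul (finSupp_swap a b)) hcrit rfl)
  rw [← hn]
  have hab' := PNat.coe_lt_coe _ _ |>.2 hab
  have hbw' := PNat.coe_le_coe _ _ |>.2 hbw
  refine Finset.sum_lt_sum (fun c hc => ?_) ⟨a, ?_, ?_⟩
  · rcases eq_or_ne c a with rfl | hca
    · rw [Equiv.Perm.mul_apply, Equiv.swap_apply_left]
      omega
    · have hcb : c ≠ b := by
        rintro rfl
        exact absurd (PNat.coe_le_coe _ _ |>.2 (Finset.mem_Icc.1 hc).2) (by omega)
      rw [Equiv.Perm.mul_apply, Equiv.swap_apply_of_ne_of_ne hca hcb]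
  · exact Finset.mem_Icc.2 ⟨one_le, PNat.coe_le_coe _ _ |>.1 hak⟩
  · rw [Equiv.Perm.mul_apply, Equiv.swap_apply_left]
    omega

theorem kBruhatLE_iff_criterion {k : ℕ} (hk : 0 < k) {u w : Equiv.Perm ℕ+} (hu : finSupp u) :
    kBruhatLE k u w ↔ KBruhatCriterion k u w := by
  lift k to ℕ+ using hk
  exact ⟨kBruhatLE.criterion hu, KBruhatCriterion.kBruhatLE hu⟩

/-- Contribution to `|ζ|` of the ordered pair of arcs `x → x'`, `y → y'`. -/
def arcWeight (x x' y y' : ℕ+) : ℤ :=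
  (if x < x' ∧ y' < y ∧ y' < x' then 1 else 0)
    - (if x < x' ∧ y < y' ∧ y < x ∧ x' < y' then 1 else 0)
    - (if x' < x ∧ y' < y ∧ y < x ∧ x' < y' then 1 else 0)
    - (if x < x' ∧ y' < y ∧ y < x then 1 else 0)

/-- The arcs `x → x'` and `y → y'` point in the same direction and cross. -/
def ArcsCross (x x' y y' : ℕ+) : Prop :=
  (x < y ∧ y < x' ∧ x' < y') ∨ (y < x ∧ x < y' ∧ y' < x') ∨
    (x' < y' ∧ y' < x ∧ x < y) ∨ (y' < x' ∧ x' < y ∧ y < x)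

theorem zlen_eq_sum {ζ : Equiv.Perm ℕ+} {F : Finset ℕ+} (hF : ∀ i, ζ i ≠ i → i ∈ F) :
    zlen ζ = ∑ x ∈ F, ∑ y ∈ F, arcWeight x (ζ x) y (ζ y) := by
  have key : ∀ (P : ℕ+ × ℕ+ → Prop) [DecidablePred P], (∀ p, P p → ζ p.1 ≠ p.1 ∧ ζ p.2 ≠ p.2) →
      ({p | P p}.ncard : ℤ) = ∑ x ∈ F, ∑ y ∈ F, if P (x, y) then (1 : ℤ) else 0 := by
    intro P _ hP
    have : {p | P p} = ((F ×ˢ F).filter P : Finset (ℕ+ × ℕ+)) := by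
      ext p
      simp only [Set.mem_ofPred_eq, Finset.coe_filter, Finset.mem_product, iff_and_self]
      exact fun h => ⟨hF _ (hP p h).1, hF _ (hP p h).2⟩
    rw [this, Set.ncard_coe_finset, Finset.natCast_card_filter, Finset.sum_product]
  have himage : {p : ℕ+ × ℕ+ | p.1 ∈ (⇑ζ) '' {α | α < ζ α} ∧ p.2 ∈ (⇑ζ) '' {β | ζ β < β} ∧
      p.2 < p.1} = Prod.map ζ ζ '' {p | p.1 < ζ p.1 ∧ ζ p.2 < p.2 ∧ ζ p.2 < ζ p.1} := by
    ext ⟨x, y⟩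
    constructor
    · rintro ⟨⟨a, ha, rfl⟩, ⟨b, hb, rfl⟩, hlt⟩
      exact ⟨(a, b), ⟨ha, hb, hlt⟩, rfl⟩
    · rintro ⟨⟨a, b⟩, ⟨ha, hb, hlt⟩, hab⟩
      obtain ⟨rfl, rfl⟩ := Prod.mk.inj hab
      exact ⟨⟨a, ha, rfl⟩, ⟨b, hb, rfl⟩, hlt⟩
  rw [zlen, himage, Set.ncard_image_of_injective _ (ζ.injective.prodMap ζ.injective),
    key _ fun p h => ⟨h.1.ne', h.2.1.ne⟩, key _ fun p h => ⟨h.1.ne', h.2.1.ne'⟩,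
    key _ fun p h => ⟨h.1.ne, h.2.1.ne⟩, key _ fun p h => ⟨h.1.ne', h.2.1.ne⟩]
  simp only [← Finset.sum_sub_distrib]
  rfl

/-- The combined weight of two arcs with four distinct endpoints counts same-direction crossings,
up to terms that telescope along cycles. -/
theorem two_mul_arcWeight_add {x x' y y' : ℕ+} (hx : x ≠ x') (hy : y ≠ y') (h₁ : x ≠ y)
    (h₂ : x ≠ y') (h₃ : x' ≠ y) (h₄ : x' ≠ y') [Decidable (ArcsCross x x' y y')] :
    2 * (arcWeight x x' y y' + arcWeight y y' x x') =
      2 * (if ArcsCross x x' y y' then 1 else 0)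
      - (if x < x' then (1 : ℤ) else -1) *
        (((if y < x then 1 else 0) - (if y' < x then 1 else 0)) +
          ((if y < x' then 1 else 0) - (if y' < x' then 1 else 0)))
      - (if y < y' then (1 : ℤ) else -1) *
        (((if x < y then 1 else 0) - (if x' < y then 1 else 0)) +
          ((if x < y' then 1 else 0) - (if x' < y' then 1 else 0))) := by
  unfold arcWeight
  simp only [ArcsCross]
  rcases hx.lt_or_gt with hx | hx <;> rcases hy.lt_or_gt with hy | hy <;>
    rcases h₁.lt_or_gt with h₁ | h₁ <;> rcases h₂.lt_or_gt with h₂ | h₂ <;>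
    rcases h₃.lt_or_gt with h₃ | h₃ <;> rcases h₄.lt_or_gt with h₄ | h₄ <;>
    first
    | (exfalso; order)
    | simp [hx, hy, h₁, h₂, h₃, h₄, hx.not_gt, hy.not_gt, h₁.not_gt, h₂.not_gt, h₃.not_gt,
        h₄.not_gt]

theorem sum_apply_sub_eq_zero {ζ : Equiv.Perm ℕ+} {A : Finset ℕ+}
    (hA : ∀ i, i ∈ A ↔ ζ i ≠ i) (f : ℕ+ → ℤ) : ∑ x ∈ A, (f x - f (ζ x)) = 0 := by
  rw [Finset.sum_sub_distrib, sub_eq_zero]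
  refine (Finset.sum_bijective ζ ζ.bijective (fun i => ?_) fun _ _ => rfl).symm
  rw [hA, hA, ζ.injective.ne_iff]

theorem disjointPerm.not_arcsCross {ζ η : Equiv.Perm ℕ+} (hζ : finSupp ζ) (hη : finSupp η)
    (hd : disjointPerm ζ η) {x y : ℕ+} (hx : ζ x ≠ x) (hy : η y ≠ y) :
    ¬ ArcsCross x (ζ x) y (η y) := by
  classical
  obtain ⟨hdis, hlen⟩ := hd
  let A := hζ.toFinset
  let B := hη.toFinset
  have hA : ∀ i, i ∈ A ↔ ζ i ≠ i := fun i => hζ.mem_toFinset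
  have hB : ∀ i, i ∈ B ↔ η i ≠ i := fun i => hη.mem_toFinset
  have hAB : Disjoint A B := Finset.disjoint_left.2 fun i hiA hiB =>
    (hB i).1 hiB (hdis i ((hA i).1 hiA))
  have hζη : ∀ i ∈ A, (ζ * η) i = ζ i := fun i hi => by
    rw [Equiv.Perm.mul_apply, hdis i ((hA i).1 hi)]
  have hηη : ∀ i ∈ B, (ζ * η) i = η i := fun i hi => by
    have h1 : η (η i) ≠ η i := fun h => (hB i).1 hi (η.injective h)
    rw [Equiv.Perm.mul_apply]
    by_contra h
    exact h1 (hdis _ h)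
  have hsupp : ∀ i, (ζ * η) i ≠ i → i ∈ A ∪ B := by
    intro i hi
    rw [Finset.mem_union]
    by_contra! h
    have h1 : ζ i = i := by simpa [hA] using h.1
    have h2 : η i = i := by simpa [hB] using h.2
    exact hi (by rw [Equiv.Perm.mul_apply, h2, h1])
  have hzero : ∑ x ∈ A, ∑ y ∈ B,
      (arcWeight x (ζ x) y (η y) + arcWeight y (η y) x (ζ x)) = 0 := by
    rw [zlen_eq_sum hsupp, zlen_eq_sum fun i => (hA i).2, zlen_eq_sum fun i => (hB i).2] at hlen
    simp only [Finset.sum_union hAB, Finset.sum_add_distrib] at hlen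
    have e : ∀ (P Q : Finset ℕ+) (σ τ : Equiv.Perm ℕ+), (∀ i ∈ P, (ζ * η) i = σ i) →
        (∀ i ∈ Q, (ζ * η) i = τ i) →
        ∑ x ∈ P, ∑ y ∈ Q, arcWeight x ((ζ * η) x) y ((ζ * η) y) =
          ∑ x ∈ P, ∑ y ∈ Q, arcWeight x (σ x) y (τ y) := fun P Q σ τ hP hQ =>
      Finset.sum_congr rfl fun i hi => Finset.sum_congr rfl fun j hj => by rw [hP i hi, hQ j hj]
    rw [e A A ζ ζ hζη hζη, e A B ζ η hζη hηη, e B A η ζ hηη hζη, e B B η η hηη hηη] at hlen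
    simp only [Finset.sum_add_distrib]
    rw [Finset.sum_comm (s := A) (t := B) (f := fun x y => arcWeight y (η y) x (ζ x))]
    linarith
  have hcount : ∑ x ∈ A, ∑ y ∈ B, (if ArcsCross x (ζ x) y (η y) then (1 : ℤ) else 0) = 0 := by
    have hne : ∀ i ∈ A, ∀ j ∈ B, i ≠ j := fun i hi j hj h =>
      Finset.disjoint_left.1 hAB hi (h ▸ hj)
    have hζA : ∀ i ∈ A, ζ i ∈ A := fun i hi =>
      (hA _).2 fun h => (hA i).1 hi (ζ.injective h)
    have hηB : ∀ i ∈ B, η i ∈ B := fun i hi =>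
      (hB _).2 fun h => (hB i).1 hi (η.injective h)
    have h2 := congrArg (fun z : ℤ => 2 * z) hzero
    simp only [Finset.mul_sum, mul_zero] at h2
    rw [Finset.sum_congr rfl fun i hi => Finset.sum_congr rfl fun j hj =>
      two_mul_arcWeight_add ((hA i).1 hi).symm ((hB j).1 hj).symm (hne i hi j hj)
        (hne i hi _ (hηB j hj)) (hne _ (hζA i hi) j hj)
        (hne _ (hζA i hi) _ (hηB j hj))] at h2
    simp only [Finset.sum_sub_distrib (s := B)] at h2
    rw [Finset.sum_sub_distrib, Finset.sum_sub_distrib] at h2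
    have ht1 : ∀ i, ∑ j ∈ B, (if i < ζ i then (1 : ℤ) else -1) *
        (((if j < i then 1 else 0) - (if η j < i then 1 else 0)) +
          ((if j < ζ i then 1 else 0) - (if η j < ζ i then 1 else 0))) = 0 := fun i => by
      rw [← Finset.mul_sum, Finset.sum_add_distrib,
        sum_apply_sub_eq_zero hB fun j => if j < i then 1 else 0,
        sum_apply_sub_eq_zero hB fun j => if j < ζ i then 1 else 0, add_zero, mul_zero]
    have ht2 : ∀ j, ∑ i ∈ A, (if j < η j then (1 : ℤ) else -1) *
        (((if i < j then 1 else 0) - (if ζ i < j then 1 else 0)) +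
          ((if i < η j then 1 else 0) - (if ζ i < η j then 1 else 0))) = 0 := fun j => by
      rw [← Finset.mul_sum, Finset.sum_add_distrib,
        sum_apply_sub_eq_zero hA fun i => if i < j then 1 else 0,
        sum_apply_sub_eq_zero hA fun i => if i < η j then 1 else 0, add_zero, mul_zero]
    rw [Finset.sum_congr rfl fun i _ => ht1 i, Finset.sum_comm (s := A) (t := B)
      (f := fun i j => (if j < η j then (1 : ℤ) else -1) *
        (((if i < j then 1 else 0) - (if ζ i < j then 1 else 0)) +
          ((if i < η j then 1 else 0) - (if ζ i < η j then 1 else 0)))),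
      Finset.sum_congr rfl fun j _ => ht2 j] at h2
    simp only [← Finset.mul_sum, Finset.sum_const_zero, sub_zero] at h2
    linarith
  have hnonneg : ∀ i j, (0 : ℤ) ≤ if ArcsCross i (ζ i) j (η j) then (1 : ℤ) else 0 :=
    fun i j => by split_ifs <;> norm_num
  have h1 := (Finset.sum_eq_zero_iff_of_nonneg fun i _ =>
    Finset.sum_nonneg fun j _ => hnonneg i j).1 hcount x ((hA x).2 hx)
  have h2 := (Finset.sum_eq_zero_iff_of_nonneg fun j _ => hnonneg x j).1 h1 y ((hB y).2 hy)
  intro h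
  rw [if_pos h] at h2
  exact one_ne_zero h2

theorem disjointPerm.symm {ζ η : Equiv.Perm ℕ+} (hd : disjointPerm ζ η) : disjointPerm η ζ := by
  have hcomm : Commute ζ η := Equiv.Perm.Disjoint.commute fun i => or_iff_not_imp_left.2 (hd.1 i)
  exact ⟨fun i hi => by_contra fun h => hi (hd.1 i h), by
    rw [← hcomm.eq, hd.2, add_comm]⟩

theorem KBruhatCriterion.left_of_mul {k : ℕ} {ζ η u : Equiv.Perm ℕ+} (hζ : finSupp ζ)
    (hη : finSupp η) (hd : disjointPerm ζ η) (h : KBruhatCriterion k u (ζ * η * u)) :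
    KBruhatCriterion k u (ζ * u) := by
  obtain ⟨h1, h2, h3, h4⟩ := h
  have hcomm : ∀ x, ζ (η x) = η (ζ x) := fun x => DFunLike.congr_fun
    (Equiv.Perm.Disjoint.commute fun i => or_iff_not_imp_left.2 (hd.1 i)).eq x
  simp only [Equiv.Perm.mul_apply] at h1 h2 h3 h4
  have hle : ∀ a : ℕ+, (a : ℕ) ≤ k → u a ≤ ζ (u a) := fun a ha => by
    by_cases hz : ζ (u a) = u a
    · exact hz.ge
    · simpa [hd.1 _ hz] using h1 a ha
  have hge : ∀ a : ℕ+, k < (a : ℕ) → ζ (u a) ≤ u a := fun a ha => by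
    by_cases hz : ζ (u a) = u a
    · exact hz.le
    · simpa [hd.1 _ hz] using h2 a ha
  refine ⟨hle, hge, fun a b hab hb h => ?_, fun a b hab ha h => ?_⟩
  · simp only [Equiv.Perm.mul_apply]
    by_contra! hcon
    have hlt : ζ (u b) < ζ (u a) := lt_of_le_of_ne hcon fun e => h.ne' (ζ.injective e)
    have hza : ζ (u a) ≠ u a := ((h.trans_le (hle b hb)).trans hlt).ne'
    have h5 := h3 a b hab hb h
    rw [hd.1 _ hza] at h5
    by_cases hzb : ζ (u b) = u b
    · rw [hcomm, hzb] at h5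
      rw [hzb] at hlt
      exact hd.not_arcsCross hζ hη hza (hlt.trans h5).ne' (Or.inl ⟨h, hlt, h5⟩)
    · rw [hd.1 _ hzb] at h5
      exact h5.not_gt hlt
  · simp only [Equiv.Perm.mul_apply]
    by_contra! hcon
    have hlt : ζ (u b) < ζ (u a) := lt_of_le_of_ne hcon fun e => h.ne' (ζ.injective e)
    have hzb : ζ (u b) ≠ u b := (hlt.trans_le ((hge a ha).trans h.le)).ne
    have h5 := h4 a b hab ha h
    rw [hd.1 _ hzb] at h5
    by_cases hza : ζ (u a) = u a
    · rw [hcomm, hza] at h5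
      rw [hza] at hlt
      exact hd.not_arcsCross hζ hη hzb (h5.trans hlt).ne
        (Or.inr (Or.inr (Or.inr ⟨h5, hlt, h⟩)))
    · rw [hd.1 _ hza] at h5
      exact h5.not_gt hlt

theorem KBruhatCriterion.mul {k : ℕ} {ζ η u : Equiv.Perm ℕ+}
    (hd : ∀ i, ζ i ≠ i → η i = i) (hζ : KBruhatCriterion k u (ζ * u))
    (hη : KBruhatCriterion k u (η * u)) : KBruhatCriterion k u (ζ * η * u) := by
  obtain ⟨h1, h2, h3, h4⟩ := hζ
  obtain ⟨g1, g2, g3, g4⟩ := hη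
  simp only [Equiv.Perm.mul_apply] at h1 h2 h3 h4 g1 g2 g3 g4
  have hval : ∀ x, (ζ (η x) = ζ x ∧ η x = x) ∨ (ζ (η x) = η x ∧ ζ x = x) := fun x => by
    have hcomm : ζ (η x) = η (ζ x) := DFunLike.congr_fun
      (Equiv.Perm.Disjoint.commute fun i => or_iff_not_imp_left.2 (hd i)).eq x
    by_cases hz : ζ x = x
    · exact Or.inr ⟨by rw [hcomm, hz], hz⟩
    · exact Or.inl ⟨by rw [hd x hz], hd x hz⟩
  refine ⟨fun a ha => ?_, fun a ha => ?_, fun a b hab hb h => ?_, fun a b hab ha h => ?_⟩ <;>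
    simp only [Equiv.Perm.mul_apply]
  · rcases hval (u a) with e | e <;> rw [e.1]
    exacts [h1 a ha, g1 a ha]
  · rcases hval (u a) with e | e <;> rw [e.1]
    exacts [h2 a ha, g2 a ha]
  · have h5 := h3 a b hab hb h
    have g5 := g3 a b hab hb h
    have hb1 := h1 b hb
    have gb1 := g1 b hb
    rcases hval (u a) with e | e <;> rcases hval (u b) with e' | e' <;> rw [e.1, e'.1]
    · exact h5
    · rw [e'.2] at h5; exact h5.trans_le gb1
    · rw [e'.2] at g5; exact g5.trans_le hb1
    · exact g5
  · have h5 := h4 a b hab ha h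
    have g5 := g4 a b hab ha h
    have ha1 := h2 a ha
    have ga1 := g2 a ha
    rcases hval (u a) with e | e <;> rcases hval (u b) with e' | e' <;> rw [e.1, e'.1]
    · exact h5
    · rw [e.2] at g5; exact ha1.trans_lt g5
    · rw [e.2] at h5; exact ga1.trans_lt h5
    · exact g5

/-- Lemma 3.3.3: for disjoint permutations `ζ` and `η`,
`u ≤_k ζ∘η∘u` iff `u ≤_k ζ∘u` and `u ≤_k η∘u`. -/
theorem stmt14 (ζ η : Equiv.Perm ℕ+) (hζ : finSupp ζ) (hη : finSupp η)
    (hd : disjointPerm ζ η) (u : Equiv.Perm ℕ+) (hu : finSupp u)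
    (k : ℕ) (hk : 0 < k) :
    kBruhatLE k u (ζ * η * u) ↔ (kBruhatLE k u (ζ * u) ∧ kBruhatLE k u (η * u)) := by
  simp only [kBruhatLE_iff_criterion hk hu]
  refine ⟨fun h => ⟨h.left_of_mul hζ hη hd, ?_⟩, fun h => h.1.mul hd.1 h.2⟩
  have hcomm : Commute ζ η := Equiv.Perm.Disjoint.commute fun i => or_iff_not_imp_left.2 (hd.1 i)
  rw [hcomm.eq] at h
  exact h.left_of_mul hη hζ hd.symm
end
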